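/- Let r > 0 and a ≥ 0. Let u be a real-valued function defined on the closed disk of radius r centered at the origin in the Euclidean plane ℝ² which is twice continuously differentiable, nonnegative, and satisfies the differential inequality Δu ≥ -a·u at every point of the open disk B_r, where Δu denotes the Laplacian of u (the sum of the two pure second partial derivatives). Then u(0) ≤ (2/π)·(a + 4/r²)·∫_{B_r} u, where the integral is taken with respect to Lebesgue measure on the open disk B_r of radius r centered at the origin. -/

import Mathlib

open MeasureTheory

/-- The Laplacian on `ℝ²`: the sum of the two pure second partial derivatives. -/
noncomputable def planeLaplacian (u : EuclideanSpace ℝ (Fin 2) → ℝ)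
    (x : EuclideanSpace ℝ (Fin 2)) : ℝ :=
  ∑ i : Fin 2,
    iteratedFDeriv ℝ 2 u x ![EuclideanSpace.single i 1, EuclideanSpace.single i 1]

section

open Laplacian Complex
open scoped Real

theorem hasDerivAt_intervalIntegral_of_continuous {F F' : ℝ → ℝ → ℝ} {a b : ℝ}
    (hF : Continuous (Function.uncurry F)) (hF' : Continuous (Function.uncurry F'))
    (h : ∀ t θ, HasDerivAt (fun s ↦ F s θ) (F' t θ) t) (t : ℝ) :
    HasDerivAt (fun s ↦ ∫ θ in a..b, F s θ) (∫ θ in a..b, F' t θ) t := by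
  obtain ⟨C, hC⟩ := ((isCompact_closedBall t 1).prod
    (isCompact_uIcc (a := a) (b := b))).exists_bound_of_continuousOn hF'.continuousOn
  refine (intervalIntegral.hasDerivAt_integral_of_dominated_loc_of_deriv_le
    (bound := fun _ ↦ C) (Metric.ball_mem_nhds t one_pos)
    (.of_forall fun s ↦ (hF.comp (Continuous.prodMk_right s)).aestronglyMeasurable)
    ((hF.comp (Continuous.prodMk_right t)).intervalIntegrable _ _)
    (hF'.comp (Continuous.prodMk_right t)).aestronglyMeasurable
    (.of_forall fun θ hθ s hs ↦ hC (s, θ) ⟨Metric.ball_subset_closedBall hs,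
      Set.uIoc_subset_uIcc hθ⟩) (by simp)
    (.of_forall fun θ _ s _ ↦ h s θ)).2

theorem laplacian_eq_fderiv_fderiv (v : ℂ → ℝ) (x : ℂ) :
    Δ v x = fderiv ℝ (fderiv ℝ v) x 1 1 + fderiv ℝ (fderiv ℝ v) x I I := by
  rw [InnerProductSpace.laplacian_eq_iteratedFDeriv_complexPlane]
  simp [iteratedFDeriv_two_apply]

theorem fderiv_fderiv_add_rotate (v : ℂ → ℝ) (x e : ℂ) :
    fderiv ℝ (fderiv ℝ v) x e e + fderiv ℝ (fderiv ℝ v) x (I * e) (I * e) =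
      ‖e‖ ^ 2 * Δ v x := by
  have h1 : e = e.re • (1 : ℂ) + e.im • I := by simp
  have h2 : I * e = (-e.im) • (1 : ℂ) + e.re • I := by simp [Complex.ext_iff]
  have h3 : ‖e‖ ^ 2 = e.re ^ 2 + e.im ^ 2 := by
    rw [← Complex.normSq_eq_norm_sq, Complex.normSq_apply]; ring
  rw [h2, h3, laplacian_eq_fderiv_fderiv]
  nth_rewrite 1 2 [h1]
  simp only [map_add, map_smul, _root_.add_apply, _root_.smul_apply,
    smul_eq_mul]
  ring

theorem mul_le_integral_circle_of_laplacian_nonneg {v : ℂ → ℝ} (hv : ContDiff ℝ 2 v) (z y : ℂ)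
    (hΔ : ∀ x, ‖x - z‖ ≤ ‖y‖ → 0 ≤ Δ v x) :
    2 * π * v z ≤ ∫ θ in (0)..(2 * π), v (z + exp (θ * I) * y) := by
  set e : ℝ → ℂ := fun θ ↦ exp (θ * I) * y with he
  have hec : Continuous e := by fun_prop
  have hed (θ : ℝ) : HasDerivAt e (I * e θ) θ := by
    have := ((((hasDerivAt_id' θ).ofReal_comp).mul_const I).cexp).mul_const y
    refine this.congr_deriv ?_
    simp only [he, ofReal_one, one_mul]
    ring
  have hen (θ : ℝ) : ‖e θ‖ = ‖y‖ := by simp [he]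
  have hv1 : ContDiff ℝ 1 (fderiv ℝ v) := hv.fderiv_right (by norm_num)
  have hc1 : Continuous (fderiv ℝ v) := hv1.continuous
  have hc2 : Continuous (fderiv ℝ (fderiv ℝ v)) := hv1.continuous_fderiv (by norm_num)
  have hd0 (x : ℂ) : HasFDerivAt v (fderiv ℝ v x) x :=
    (hv.differentiable (by norm_num) x).hasFDerivAt
  have hd1 (x : ℂ) : HasFDerivAt (fderiv ℝ v) (fderiv ℝ (fderiv ℝ v) x) x :=
    (hv1.differentiable (by norm_num) x).hasFDerivAt
  have hray (t θ : ℝ) : HasDerivAt (fun s : ℝ ↦ z + s • e θ) (e θ) t := by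
    simpa using ((hasDerivAt_id t).smul_const (e θ)).const_add z
  set A : ℝ → ℝ := fun t ↦ ∫ θ in (0)..(2 * π), v (z + t • e θ) with hA
  set A1 : ℝ → ℝ := fun t ↦ ∫ θ in (0)..(2 * π), fderiv ℝ v (z + t • e θ) (e θ) with hA1
  set A2 : ℝ → ℝ := fun t ↦ ∫ θ in (0)..(2 * π),
    fderiv ℝ (fderiv ℝ v) (z + t • e θ) (e θ) (e θ) with hA2
  have hAd (t : ℝ) : HasDerivAt A (A1 t) t := by
    refine hasDerivAt_intervalIntegral_of_continuous
      (F := fun t θ ↦ v (z + t • e θ)) (F' := fun t θ ↦ fderiv ℝ v (z + t • e θ) (e θ))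
      ?_ ?_ (fun t θ ↦ ?_) t
    · have := hv.continuous; fun_prop
    · fun_prop
    · exact (hd0 _).comp_hasDerivAt t (hray t θ)
  have hA1d (t : ℝ) : HasDerivAt A1 (A2 t) t := by
    refine hasDerivAt_intervalIntegral_of_continuous
      (F := fun t θ ↦ fderiv ℝ v (z + t • e θ) (e θ))
      (F' := fun t θ ↦ fderiv ℝ (fderiv ℝ v) (z + t • e θ) (e θ) (e θ))
      ?_ ?_ (fun t θ ↦ ?_) t
    · fun_prop
    · fun_prop
    · simpa using ((hd1 _).comp_hasDerivAt t (hray t θ)).clm_apply (hasDerivAt_const t (e θ))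
  have hang (t θ : ℝ) : HasDerivAt (fun φ ↦ fderiv ℝ v (z + t • e φ) (I * e φ))
      (fderiv ℝ (fderiv ℝ v) (z + t • e θ) (t • (I * e θ)) (I * e θ) +
        fderiv ℝ v (z + t • e θ) (-e θ)) θ := by
    have h1 : HasDerivAt (fun φ ↦ z + t • e φ) (t • (I * e θ)) θ :=
      ((hed θ).const_smul t).const_add z
    have h2 : HasDerivAt (fun φ ↦ I * e φ) (-e θ) θ := by
      have := (hed θ).const_mul I
      rwa [← mul_assoc, I_mul_I, neg_one_mul] at this
    exact ((hd1 _).comp_hasDerivAt θ h1).clm_apply h2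
  have hper : e (2 * π) = e 0 := by simp [he]
  have hang0 (t : ℝ) : ∫ θ in (0)..(2 * π),
      (fderiv ℝ (fderiv ℝ v) (z + t • e θ) (t • (I * e θ)) (I * e θ) +
        fderiv ℝ v (z + t • e θ) (-e θ)) = 0 := by
    rw [intervalIntegral.integral_eq_sub_of_hasDerivAt (fun θ _ ↦ hang t θ)
      (Continuous.intervalIntegrable (by fun_prop) _ _), hper, sub_self]
  have hkey (t : ℝ) (ht : t ∈ Set.Icc (0 : ℝ) 1) : 0 ≤ A1 t + t * A2 t := by
    have : A1 t + t * A2 t = ∫ θ in (0)..(2 * π), t * (‖e θ‖ ^ 2 * Δ v (z + t • e θ)) := by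
      trans A1 t + t * A2 t + ∫ θ in (0)..(2 * π),
        (fderiv ℝ (fderiv ℝ v) (z + t • e θ) (t • (I * e θ)) (I * e θ) +
          fderiv ℝ v (z + t • e θ) (-e θ))
      · rw [hang0, add_zero]
      simp only [hA1, hA2]
      rw [← intervalIntegral.integral_const_mul, ← intervalIntegral.integral_add,
        ← intervalIntegral.integral_add]
      · refine intervalIntegral.integral_congr fun θ _ ↦ ?_
        simp only [← fderiv_fderiv_add_rotate, map_smul, _root_.smul_apply, smul_eq_mul, map_neg]
        ring
      all_goals exact Continuous.intervalIntegrable (by fun_prop) _ _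
    rw [this]
    refine intervalIntegral.integral_nonneg (by positivity) fun θ _ ↦ ?_
    refine mul_nonneg ht.1 (mul_nonneg (by positivity) (hΔ _ ?_))
    simpa [hen, abs_of_nonneg ht.1] using mul_le_of_le_one_left (norm_nonneg y) ht.2
  have hmono : MonotoneOn (fun t ↦ t * A1 t) (Set.Icc 0 1) := by
    have hd (t : ℝ) : HasDerivAt (fun t ↦ t * A1 t) (A1 t + t * A2 t) t := by
      simpa using (hasDerivAt_id' t).fun_mul (hA1d t)
    refine monotoneOn_of_deriv_nonneg (convex_Icc 0 1)
      (fun t _ ↦ (hd t).continuousAt.continuousWithinAt)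
      (fun t _ ↦ (hd t).differentiableAt.differentiableWithinAt) fun t ht ↦ ?_
    rw [(hd t).deriv]
    exact hkey t (interior_subset ht)
  have hmonoA : MonotoneOn A (Set.Icc 0 1) := by
    refine monotoneOn_of_deriv_nonneg (convex_Icc 0 1)
      (fun t _ ↦ (hAd t).continuousAt.continuousWithinAt)
      (fun t _ ↦ (hAd t).differentiableAt.differentiableWithinAt) fun t ht ↦ ?_
    rw [(hAd t).deriv]
    rw [interior_Icc] at ht
    have := hmono (Set.left_mem_Icc.2 zero_le_one) (Set.Ioo_subset_Icc_self ht) ht.1.le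
    simp only [zero_mul] at this
    exact nonneg_of_mul_nonneg_right this ht.1
  simpa [hA] using hmonoA (Set.left_mem_Icc.2 zero_le_one) (Set.right_mem_Icc.2 zero_le_one)
    zero_le_one

theorem setIntegral_ball_rotate (f : ℂ → ℝ) (z : ℂ) (δ θ : ℝ) :
    ∫ y in Metric.ball 0 δ, f (z + exp (θ * I) * y) = ∫ x in Metric.ball z δ, f x := by
  have hmp : MeasurePreserving (fun y : ℂ ↦ z + exp (θ * I) * y) :=
    (measurePreserving_add_left volume z).comp (rotation (Circle.exp θ)).measurePreserving
  have hemb : MeasurableEmbedding (fun y : ℂ ↦ z + exp (θ * I) * y) :=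
    (measurableEmbedding_addLeft z).comp
      (rotation (Circle.exp θ)).toHomeomorph.measurableEmbedding
  rw [← hmp.setIntegral_preimage_emb hemb f (Metric.ball z δ)]
  congr 2
  ext y
  simp [dist_eq_norm]

theorem mul_le_setIntegral_ball_of_laplacian_nonneg {v : ℂ → ℝ} (hv : ContDiff ℝ 2 v) (z : ℂ)
    {δ : ℝ} (hδ : 0 ≤ δ) (hΔ : ∀ x ∈ Metric.ball z δ, 0 ≤ Δ v x) :
    π * δ ^ 2 * v z ≤ ∫ x in Metric.ball z δ, v x := by
  have hvc := hv.continuous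
  have hint : Integrable (Function.uncurry fun (θ : ℝ) (y : ℂ) ↦ v (z + exp (θ * I) * y))
      ((volume.restrict (Set.uIoc 0 (2 * π))).prod (volume.restrict (Metric.ball 0 δ))) := by
    rw [Measure.prod_restrict]
    refine IntegrableOn.mono_set (t := Set.uIcc 0 (2 * π) ×ˢ Metric.closedBall 0 δ) ?_
      (Set.prod_mono Set.uIoc_subset_uIcc Metric.ball_subset_closedBall)
    refine ContinuousOn.integrableOn_compact
      (isCompact_uIcc.prod (isCompact_closedBall 0 δ)) (Continuous.continuousOn ?_)
    fun_prop
  have hswap := intervalIntegral_integral_swap hint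
  simp only [setIntegral_ball_rotate, intervalIntegral.integral_const, sub_zero, smul_eq_mul]
    at hswap
  have hle : ∫ y in Metric.ball (0 : ℂ) δ, 2 * π * v z ≤
      ∫ y in Metric.ball (0 : ℂ) δ, ∫ θ in (0)..(2 * π), v (z + exp (θ * I) * y) := by
    refine setIntegral_mono_on (integrableOn_const measure_ball_lt_top.ne) ?_
      Metric.isOpen_ball.measurableSet fun y hy ↦ ?_
    · have := hint.integral_prod_right
      simpa only [IntegrableOn, intervalIntegral.intervalIntegral_eq_integral_uIoc,
        Function.uncurry, if_pos Real.two_pi_pos.le, one_smul] using this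
    · refine mul_le_integral_circle_of_laplacian_nonneg hv z y fun x hx ↦ hΔ x ?_
      rw [mem_ball_iff_norm]
      exact hx.trans_lt (by simpa using hy)
  rw [← hswap, setIntegral_const, measureReal_def, Complex.volume_ball, smul_eq_mul] at hle
  simp [hδ] at hle
  have := Real.pi_pos
  nlinarith

theorem exists_contDiff_eventuallyEq {f : ℂ → ℝ} {n : ℕ∞} {z : ℂ} {δ ρ : ℝ} (hδ : 0 ≤ δ)
    (hρ : δ < ρ) (hf : ContDiffOn ℝ n f (Metric.ball z ρ)) :
    ∃ g : ℂ → ℝ, ContDiff ℝ n g ∧ ∀ x ∈ Metric.closedBall z δ, g =ᶠ[nhds x] f := by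
  let b : ContDiffBump z := ⟨(2 * δ + ρ) / 3, (δ + 2 * ρ) / 3, by linarith, by linarith⟩
  refine ⟨fun x ↦ b x * f x, contDiff_iff_contDiffAt.2 fun x ↦ ?_, fun x hx ↦ ?_⟩
  · by_cases hx : x ∈ Metric.ball z ρ
    · exact b.contDiffAt.mul (hf.contDiffAt (Metric.isOpen_ball.mem_nhds hx))
    · have hx' : x ∉ tsupport b := by
        rw [b.tsupport_eq]
        refine fun h ↦ hx (Metric.closedBall_subset_ball ?_ h)
        change (δ + 2 * ρ) / 3 < ρ
        linarith
      refine (contDiffAt_const (c := (0 : ℝ))).congr_of_eventuallyEq ?_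
      filter_upwards [notMem_tsupport_iff_eventuallyEq.1 hx'] with y hy
      simp [hy]
  · have hx' : x ∈ Metric.ball z b.rIn := by
      refine Metric.closedBall_subset_ball ?_ hx
      change δ < (2 * δ + ρ) / 3
      linarith
    filter_upwards [b.eventuallyEq_one_of_mem_ball hx'] with y hy
    simp [hy]

theorem laplacian_norm_sub_sq (z x : ℂ) : Δ (fun x ↦ ‖x - z‖ ^ 2) x = 4 := by
  have h1 : fderiv ℝ (fun x ↦ ‖x - z‖ ^ 2) = fun x ↦ (2 • innerSL ℝ (E := ℂ)) (x - z) := by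
    ext1 y
    rw [fderiv_comp_sub (f := fun x : ℂ ↦ ‖x‖ ^ 2), fderiv_norm_sq]
    rfl
  have h2 : fderiv ℝ (fun x : ℂ ↦ (2 • innerSL ℝ (E := ℂ)) (x - z)) x = 2 • innerSL ℝ := by
    rw [fderiv_comp_sub (f := ⇑(2 • innerSL ℝ (E := ℂ)))]
    exact (2 • innerSL ℝ (E := ℂ)).hasFDerivAt.fderiv
  rw [laplacian_eq_fderiv_fderiv, h1, h2]
  change 2 • inner ℝ (1 : ℂ) 1 + 2 • inner ℝ I I = (4 : ℝ)
  norm_num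

theorem setIntegral_ball_norm_sub_sq (z : ℂ) {δ : ℝ} (hδ : 0 ≤ δ) :
    ∫ x in Metric.ball z δ, ‖x - z‖ ^ 2 = π * δ ^ 4 / 2 := by
  rw [← setIntegral_ball_rotate _ z δ 0]
  have h := integral_fun_norm_addHaar (volume : Measure ℂ)
    (fun t ↦ (Set.Iio δ).indicator (fun t ↦ t ^ 2) t)
  have hball : (fun x : ℂ ↦ (Set.Iio δ).indicator (fun t ↦ t ^ 2) ‖x‖) =
      (Metric.ball 0 δ).indicator (fun x : ℂ ↦ ‖x‖ ^ 2) := by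
    ext x; simp [Set.indicator]
  have hright : (fun t : ℝ ↦ t ^ (Module.finrank ℝ ℂ - 1) •
      (Set.Iio δ).indicator (fun t ↦ t ^ 2) t) = (Set.Iio δ).indicator (fun t ↦ t ^ 3) := by
    ext t
    simp [Set.indicator]
    congr 1; ring
  rw [hball, hright, integral_indicator Metric.isOpen_ball.measurableSet,
    setIntegral_indicator measurableSet_Iio, Set.Ioi_inter_Iio, ← integral_Ioc_eq_integral_Ioo,
    ← intervalIntegral.integral_of_le hδ, integral_pow, measureReal_def, Complex.volume_ball] at h
  simp at h ⊢
  rw [h]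
  ring

theorem mul_le_setIntegral_ball_of_le_laplacian {u : ℂ → ℝ} {z : ℂ} {δ ρ K : ℝ} (hδ : 0 ≤ δ)
    (hρ : δ < ρ) (hu : ContDiffOn ℝ 2 u (Metric.ball z ρ))
    (hΔ : ∀ x ∈ Metric.ball z δ, -(4 * K) ≤ Δ u x) :
    π * δ ^ 2 * u z ≤ (∫ x in Metric.ball z δ, u x) + K * (π * δ ^ 4 / 2) := by
  obtain ⟨g, hg, hgu⟩ := exists_contDiff_eventuallyEq (n := 2) hδ hρ hu
  have hq : ContDiff ℝ 2 fun x : ℂ ↦ ‖x - z‖ ^ 2 := (contDiff_id.sub contDiff_const).norm_sq ℝ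
  have hKq : ContDiff ℝ 2 (K • fun x : ℂ ↦ ‖x - z‖ ^ 2) := contDiff_const.smul hq
  have hint {f : ℂ → ℝ} (hf : Continuous f) : IntegrableOn f (Metric.ball z δ) :=
    (hf.continuousOn.integrableOn_compact (isCompact_closedBall z δ)).mono_set
      Metric.ball_subset_closedBall
  have h := mul_le_setIntegral_ball_of_laplacian_nonneg (hg.add hKq) z hδ fun x hx ↦ by
    change 0 ≤ Δ (g + K • fun x ↦ ‖x - z‖ ^ 2) x
    rw [ContDiffAt.laplacian_add hg.contDiffAt hKq.contDiffAt,
      InnerProductSpace.laplacian_smul K hq.contDiffAt, laplacian_norm_sub_sq,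
      (InnerProductSpace.laplacian_congr_nhds
        (hgu x (Metric.ball_subset_closedBall hx))).eq_of_nhds, smul_eq_mul]
    linarith [hΔ x hx]
  rw [integral_add (hint hg.continuous) (hint hKq.continuous)] at h
  simp only [Pi.smul_apply, smul_eq_mul] at h
  rw [integral_const_mul,
    setIntegral_ball_norm_sub_sq z hδ, (hgu z (Metric.mem_closedBall_self hδ)).eq_of_nhds,
    setIntegral_congr_fun Metric.isOpen_ball.measurableSet fun x hx ↦
      (hgu x (Metric.ball_subset_closedBall hx)).eq_of_nhds] at h
  simpa using h

theorem le_setIntegral_ball_of_neg_mul_le_laplacian {r a : ℝ} (hr : 0 < r) (ha : 0 ≤ a)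
    {u : ℂ → ℝ} (hu : ContDiffOn ℝ 2 u (Metric.closedBall 0 r))
    (hnonneg : ∀ x ∈ Metric.closedBall 0 r, 0 ≤ u x)
    (hlap : ∀ x ∈ Metric.ball 0 r, -a * u x ≤ Δ u x) :
    u 0 ≤ (2 / π) * (a + 4 / r ^ 2) * ∫ x in Metric.ball 0 r, u x := by
  have hπ := Real.pi_pos
  have hball : Metric.ball (0 : ℂ) r ⊆ Metric.closedBall 0 r := Metric.ball_subset_closedBall
  have hint : IntegrableOn u (Metric.ball 0 r) :=
    (hu.continuousOn.integrableOn_compact (isCompact_closedBall 0 r)).mono_set hball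
  set J := ∫ x in Metric.ball 0 r, u x with hJ
  have hJ0 : 0 ≤ J := setIntegral_nonneg Metric.isOpen_ball.measurableSet
    fun x hx ↦ hnonneg x (hball hx)
  obtain ⟨z, hz, hmax⟩ := (isCompact_closedBall (0 : ℂ) r).exists_isMaxOn
    ⟨0, Metric.mem_closedBall_self hr.le⟩
    (f := fun x ↦ (r - ‖x‖) ^ 2 * u x)
    (ContinuousOn.mul (Continuous.continuousOn (by fun_prop)) hu.continuousOn)
  have hmax' (x : ℂ) (hx : ‖x‖ ≤ r) : (r - ‖x‖) ^ 2 * u x ≤ (r - ‖z‖) ^ 2 * u z :=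
    hmax (by simpa using hx)
  have h0 : r ^ 2 * u 0 ≤ (r - ‖z‖) ^ 2 * u z := by simpa using hmax' 0 (by simpa using hr.le)
  have hu0 : 0 ≤ u 0 := hnonneg 0 (Metric.mem_closedBall_self hr.le)
  have huz : 0 ≤ u z := hnonneg z hz
  have hzr : ‖z‖ ≤ r := by simpa using hz
  rcases hzr.eq_or_lt with hzr | hzr
  · have : u 0 ≤ 0 := by
      rw [hzr, sub_self] at h0
      nlinarith [pow_pos hr 2]
    exact this.trans (by positivity)
  obtain ⟨ε, hε⟩ : ∃ ε, ε = (r - ‖z‖) / 2 := ⟨_, rfl⟩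
  have hε0 : 0 < ε := by rw [hε]; linarith
  have hrz : r - ‖z‖ = 2 * ε := by rw [hε]; ring
  have hεr : 2 * ε ≤ r := by linarith [norm_nonneg z]
  rw [hrz] at h0
  -- Within distance `ε` of the maximum point, `u` is at most four times its value there.
  have hnorm {x : ℂ} {ρ : ℝ} (hx : x ∈ Metric.ball z ρ) : ‖x‖ < ‖z‖ + ρ := by
    rw [mem_ball_iff_norm] at hx
    linarith [norm_le_norm_add_norm_sub z x, norm_sub_rev z x]
  have hu4 {x : ℂ} (hx : x ∈ Metric.ball z ε) : u x ≤ 4 * u z := by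
    have hxε := hnorm hx
    have hx0 := hnonneg x (by simp; linarith)
    have h1 := hmax' x (by linarith)
    have h2 : ε ^ 2 ≤ (r - ‖x‖) ^ 2 := by gcongr; linarith
    rw [hrz] at h1
    nlinarith [pow_pos hε0 2]
  have key {δ : ℝ} (hδ : 0 < δ) (hδε : δ ≤ ε) :
      π * δ ^ 2 * u z ≤ J + a * u z * (π * δ ^ 4 / 2) := by
    have hsub : Metric.ball z δ ⊆ Metric.ball 0 r := fun x hx ↦ by
      have := hnorm hx
      simp
      linarith
    refine (mul_le_setIntegral_ball_of_le_laplacian (ρ := 2 * ε) (K := a * u z) hδ.le (by linarith)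
      (hu.mono fun x hx ↦ ?_) fun x hx ↦ ?_).trans ?_
    · have := hnorm hx
      simp
      linarith
    · have h1 := hlap x (hsub hx)
      have h2 := mul_le_mul_of_nonneg_left (hu4 (Metric.ball_subset_ball hδε hx)) ha
      linarith
    · gcongr
      exact setIntegral_mono_set hint
        ((ae_restrict_iff' Metric.isOpen_ball.measurableSet).2
          (.of_forall fun x hx ↦ hnonneg x (hball hx))) (.of_forall hsub)
  have hgoal : π * u 0 ≤ 2 * (a + 4 / r ^ 2) * J := by
    rcases le_total (a * ε ^ 2) 1 with hcase | hcase
    · have h1 := key hε0 le_rfl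
      have h2 : a * ε ^ 2 * (ε ^ 2 * u z * π) ≤ 1 * (ε ^ 2 * u z * π) := by gcongr
      have h3 : π * (r ^ 2 * u 0) ≤ 8 * J := by nlinarith
      have h4 : π * u 0 ≤ 8 / r ^ 2 * J := by
        rw [div_mul_eq_mul_div, le_div_iff₀ (by positivity)]
        linarith
      have h5 : 0 ≤ a * J := by positivity
      linear_combination h4 + 2 * h5
    · have ha0 : 0 < a := by
        by_contra! h
        nlinarith [pow_pos hε0 2]
      have hs2 : (√a)⁻¹ ^ 2 = a⁻¹ := by rw [inv_pow, Real.sq_sqrt ha]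
      have h1 := key (δ := (√a)⁻¹) (by positivity) (by
        refine le_of_sq_le_sq ?_ hε0.le
        rw [hs2, inv_le_iff_one_le_mul₀ ha0]
        linarith)
      rw [show (√a)⁻¹ ^ 4 = ((√a)⁻¹ ^ 2) ^ 2 by ring, hs2] at h1
      have h2 : π * u z ≤ 2 * a * J := by
        field_simp at h1
        linarith
      have h3 : u 0 ≤ u z := by
        have : (2 * ε) ^ 2 * u z ≤ r ^ 2 * u z := by gcongr
        nlinarith [pow_pos hr 2]
      have h4 : 0 ≤ 4 / r ^ 2 * J := by positivity
      have h5 : π * u 0 ≤ π * u z := by gcongr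
      linarith
  calc u 0 = π * u 0 / π := by field_simp
    _ ≤ 2 * (a + 4 / r ^ 2) * J / π := by gcongr
    _ = _ := by ring

theorem laplacian_comp_repr {u : EuclideanSpace ℝ (Fin 2) → ℝ}
    {s : Set (EuclideanSpace ℝ (Fin 2))}
    (hs : IsOpen s) (hu : ContDiffOn ℝ 2 u s) {x : ℂ} (hx : orthonormalBasisOneI.repr x ∈ s) :
    Δ (u ∘ orthonormalBasisOneI.repr) x = planeLaplacian u (orthonormalBasisOneI.repr x) := by
  set φ := orthonormalBasisOneI.repr.toContinuousLinearEquiv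
  have hpre : IsOpen (φ ⁻¹' s) := hs.preimage φ.continuous
  have h := φ.toContinuousLinearMap.iteratedFDerivWithin_comp_right hu hs.uniqueDiffOn
    hpre.uniqueDiffOn hx le_rfl
  have hs2 : iteratedFDerivWithin ℝ 2 u s (φ x) = iteratedFDeriv ℝ 2 u (φ x) :=
    iteratedFDerivWithin_of_isOpen 2 hs hx
  have h' : iteratedFDeriv ℝ 2 (u ∘ φ) x = (iteratedFDeriv ℝ 2 u (φ x)).compContinuousLinearMap
      fun _ ↦ φ.toContinuousLinearMap := by
    rw [← hs2, ← iteratedFDerivWithin_of_isOpen 2 hpre hx]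
    exact h
  rw [InnerProductSpace.laplacian_eq_iteratedFDeriv_orthonormalBasis _ orthonormalBasisOneI,
    planeLaplacian]
  refine Finset.sum_congr rfl fun i _ ↦ ?_
  change iteratedFDeriv ℝ 2 (u ∘ φ) x _ = iteratedFDeriv ℝ 2 u (φ x) _
  rw [h', ContinuousMultilinearMap.compContinuousLinearMap_apply]
  congr 1
  ext1 j
  fin_cases j <;> exact orthonormalBasisOneI.repr_self i

end

/-- Mean value estimate (Dostoglou–Salamon, Lemma 7.3): if `u ≥ 0` is `C²` on the closed
disk of radius `r` and satisfies `Δu ≥ -a·u` on the open disk, then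
`u(0) ≤ (2/π)(a + 4/r²) ∫_{B_r} u`. -/
theorem mean_value_estimate (r a : ℝ) (hr : 0 < r) (ha : 0 ≤ a)
    (u : EuclideanSpace ℝ (Fin 2) → ℝ)
    (hu : ContDiffOn ℝ 2 u (Metric.closedBall (0 : EuclideanSpace ℝ (Fin 2)) r))
    (hnonneg : ∀ x ∈ Metric.closedBall (0 : EuclideanSpace ℝ (Fin 2)) r, 0 ≤ u x)
    (hlap : ∀ x ∈ Metric.ball (0 : EuclideanSpace ℝ (Fin 2)) r,
      -a * u x ≤ planeLaplacian u x) :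
    u 0 ≤ (2 / Real.pi) * (a + 4 / r ^ 2) *
      ∫ x in Metric.ball (0 : EuclideanSpace ℝ (Fin 2)) r, u x := by
  set φ := Complex.orthonormalBasisOneI.repr
  have hmp : MeasurePreserving φ := Complex.orthonormalBasisOneI.measurePreserving_repr
  have hmem {x : ℂ} : φ x ∈ Metric.closedBall 0 r ↔ x ∈ Metric.closedBall 0 r := by simp
  have hmem' {x : ℂ} : φ x ∈ Metric.ball 0 r ↔ x ∈ Metric.ball 0 r := by simp
  have h := le_setIntegral_ball_of_neg_mul_le_laplacian hr ha (u := u ∘ φ)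
    (hu.comp φ.contDiff.contDiffOn fun x hx ↦ hmem.2 hx) (fun x hx ↦ hnonneg _ (hmem.2 hx))
    fun x hx ↦ by
      rw [laplacian_comp_repr Metric.isOpen_ball (hu.mono Metric.ball_subset_closedBall)
        (hmem'.2 hx)]
      exact hlap _ (hmem'.2 hx)
  have hpre : φ ⁻¹' Metric.ball 0 r = Metric.ball 0 r := Set.ext fun x ↦ hmem'
  rw [← hmp.setIntegral_preimage_emb φ.toHomeomorph.measurableEmbedding, hpre]
  simpa using h
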